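/- Divergence of the untilted (Genz separation-of-variables) estimator without strong positive covariance (Theorem 3, second part): define the second moment of the untilted estimator M₀(γ) = ∫_{𝒞_γ} exp(ψ_γ(x;0)) φ_d(x) dx. If (Lᵀl*)_k ≤ 0 for at least one index k ∈ {1,…,d}, then M₀(γ)/ℓ(γ)² → ∞ as γ → ∞, i.e., the relative error of the separation-of-variables estimator diverges. -/

import Mathlib

open MeasureTheory Real Filter Matrix

/-- Standard normal density on ℝ. -/
noncomputable def stdPdf (t : ℝ) : ℝ := (Real.sqrt (2 * Real.pi))⁻¹ * Real.exp (-t ^ 2 / 2)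

/-- Standard normal cumulative distribution function Φ. -/
noncomputable def Phi (t : ℝ) : ℝ := ∫ s in Set.Iic t, stdPdf s

/-- Standard `d`-dimensional normal density φ_d(x) = (2π)^{-d/2} exp(-‖x‖²/2). -/
noncomputable def phiD {d : ℕ} (x : Fin d → ℝ) : ℝ :=
  ((Real.sqrt (2 * Real.pi)) ^ d)⁻¹ * Real.exp (-(∑ i, x i ^ 2) / 2)

/-- The region of integration 𝒞_γ = {x : Lx ≥ γ Σ l*}, where Σ = LLᵀ. -/
def Cgam {d : ℕ} (L : Matrix (Fin d) (Fin d) ℝ) (lstar : Fin d → ℝ) (γ : ℝ) :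
    Set (Fin d → ℝ) := {x | ∀ i, γ * (L * Lᵀ).mulVec lstar i ≤ L.mulVec x i}

/-- ℓ(γ) = P(LZ ≥ γ Σ l*) = ∫_{𝒞_γ} φ_d(x) dx. -/
noncomputable def ellGam {d : ℕ} (L : Matrix (Fin d) (Fin d) ℝ) (lstar : Fin d → ℝ)
    (γ : ℝ) : ℝ := ∫ x in Cgam L lstar γ, phiD x

/-- One-sided sequential bound l̃ᵧ_k(x) = (γ(Σl*)_k − Σ_{j<k} L_{kj} x_j)/L_{kk}. -/
noncomputable def lTilGam {d : ℕ} (L : Matrix (Fin d) (Fin d) ℝ) (lstar : Fin d → ℝ) (γ : ℝ)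
    (x : Fin d → ℝ) (k : Fin d) : ℝ :=
  (γ * (L * Lᵀ).mulVec lstar k - ∑ j ∈ Finset.Iio k, L k j * x j) / L k k

/-- ψ_γ(x;μ) = −xᵀμ + ‖μ‖²/2 + Σ_k log(1 − Φ(l̃ᵧ_k(x) − μ_k)). -/
noncomputable def psiGam {d : ℕ} (L : Matrix (Fin d) (Fin d) ℝ) (lstar : Fin d → ℝ) (γ : ℝ)
    (x μ : Fin d → ℝ) : ℝ :=
  -(∑ i, x i * μ i) + (∑ i, μ i ^ 2) / 2 +
    ∑ k, Real.log (1 - Phi (lTilGam L lstar γ x k - μ k))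

/-- Second moment of the exponentially tilted estimator with tilting parameter μ(γ):
M(γ) = ∫_{𝒞_γ} exp(ψ_γ(x;μ(γ))) φ_d(x) dx. -/
noncomputable def Mgam {d : ℕ} (L : Matrix (Fin d) (Fin d) ℝ) (lstar : Fin d → ℝ)
    (μ : ℝ → Fin d → ℝ) (γ : ℝ) : ℝ :=
  ∫ x in Cgam L lstar γ, Real.exp (psiGam L lstar γ x (μ γ)) * phiD x

lemma stdPdf_pos (t : ℝ) : 0 < stdPdf t := by unfold stdPdf; positivity

lemma stdPdf_eq_gaussianPDFReal : stdPdf = ProbabilityTheory.gaussianPDFReal 0 1 := by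
  ext t
  simp [stdPdf, ProbabilityTheory.gaussianPDFReal]

lemma integrable_stdPdf : Integrable stdPdf := by
  rw [stdPdf_eq_gaussianPDFReal]
  exact ProbabilityTheory.integrable_gaussianPDFReal 0 1

lemma one_sub_Phi (t : ℝ) : 1 - Phi t = ∫ s in Set.Ioi t, stdPdf s := by
  have h1 : ∫ s, stdPdf s = 1 := by
    rw [stdPdf_eq_gaussianPDFReal]
    exact ProbabilityTheory.integral_gaussianPDFReal_eq_one 0 one_ne_zero
  have h2 := integral_add_compl (measurableSet_Iic (a := t)) integrable_stdPdf
  rw [Set.compl_Iic, h1] at h2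
  unfold Phi
  linarith

lemma stdPdf_anti {s t : ℝ} (hs : 0 ≤ s) (hst : s ≤ t) : stdPdf t ≤ stdPdf s := by
  unfold stdPdf
  gcongr

lemma mul_stdPdf_le_one_sub_Phi {t s h : ℝ} (hts : t ≤ s) (hs : 0 ≤ s) (hh : 0 ≤ h) :
    h * stdPdf (s + h) ≤ 1 - Phi t := by
  rw [one_sub_Phi]
  have h1 : ∫ r in Set.Ioc s (s + h), stdPdf r ≤ ∫ r in Set.Ioi t, stdPdf r :=
    setIntegral_mono_set integrable_stdPdf.integrableOn
      (Eventually.of_forall fun r => (stdPdf_pos r).le)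
      (LE.le.eventuallyLE fun r hr => hts.trans_lt hr.1)
  refine le_trans ?_ h1
  have h2 := setIntegral_ge_of_const_le (μ := volume) (f := stdPdf) (c := stdPdf (s + h))
    (measurableSet_Ioc (a := s) (b := s + h)) (by simp)
    (fun r hr => stdPdf_anti (hs.trans hr.1.le) hr.2) integrable_stdPdf.integrableOn
  simpa [Measure.real, hh] using h2

lemma one_sub_Phi_pos (t : ℝ) : 0 < 1 - Phi t := by
  have h := mul_stdPdf_le_one_sub_Phi (le_abs_self t) (abs_nonneg t) zero_le_one
  have := stdPdf_pos (|t| + 1)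
  linarith

lemma Phi_nonneg (t : ℝ) : 0 ≤ Phi t :=
  integral_nonneg fun r => (stdPdf_pos r).le

lemma monotone_Phi : Monotone Phi := fun _ _ hst =>
  setIntegral_mono_set integrable_stdPdf.integrableOn
    (Eventually.of_forall fun r => (stdPdf_pos r).le)
    (LE.le.eventuallyLE (Set.Iic_subset_Iic.2 hst))

/-- Lower bound for the normal tail near `γ * c`, without the factor `γ⁻¹` if `c ≤ 0`. -/
lemma one_sub_Phi_lower {γ c t : ℝ} (hγ : 1 ≤ γ) (ht : t ≤ γ * c + γ⁻¹) {w : ℝ}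
    (hw : w = 1 ∨ w = γ ∧ c ≤ 0) :
    w * γ⁻¹ * ((√(2 * π))⁻¹ * exp (-(2 * |c| + 2)) * exp (-(γ ^ 2 * c ^ 2 / 2))) ≤ 1 - Phi t := by
  have hγ0 : 0 < γ := by linarith
  have hi : γ⁻¹ ≤ 1 := inv_le_one_of_one_le₀ hγ
  have hi0 : 0 < γ⁻¹ := by positivity
  have hm : γ * γ⁻¹ = 1 := mul_inv_cancel₀ hγ0.ne'
  rcases hw with rfl | ⟨rfl, hc⟩
  · have h := mul_stdPdf_le_one_sub_Phi (t := t) (s := γ * |c| + γ⁻¹) (h := γ⁻¹)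
      (ht.trans (by gcongr; exact le_abs_self c)) (by positivity) (by positivity)
    refine le_trans ?_ h
    rw [one_mul, stdPdf, mul_assoc, ← exp_add]
    gcongr
    have e : (γ * |c| + γ⁻¹ + γ⁻¹) ^ 2 =
        γ ^ 2 * c ^ 2 + 4 * (γ * γ⁻¹) * |c| + 4 * γ⁻¹ ^ 2 := by
      rw [← sq_abs c]; ring
    rw [hm] at e
    nlinarith
  · have h := mul_stdPdf_le_one_sub_Phi (t := t) (s := 1) (h := 1)
      (ht.trans (by nlinarith)) (by positivity) (by positivity)
    refine le_trans ?_ h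
    rw [hm, one_mul, one_mul, stdPdf, mul_assoc, ← exp_add]
    gcongr
    have := abs_nonneg c
    nlinarith [sq_nonneg (w * c)]

lemma phiD_pos {d : ℕ} (x : Fin d → ℝ) : 0 < phiD x := by unfold phiD; positivity

lemma integrable_phiD {d : ℕ} : Integrable (phiD (d := d)) := by
  have h : (phiD (d := d)) = fun x => ∏ i, stdPdf (x i) := by
    ext x
    simp only [phiD, stdPdf, Finset.prod_mul_distrib, Finset.prod_const, ← exp_sum,
      Finset.card_univ, Fintype.card_fin, inv_pow]
    rw [← Finset.sum_div, Finset.sum_neg_distrib]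
  rw [h]
  exact Integrable.fintype_prod fun _ => integrable_stdPdf

section Cone

variable {d : ℕ} (L : Matrix (Fin d) (Fin d) ℝ) (l : Fin d → ℝ)

lemma mem_Cgam_iff {γ : ℝ} (hγ : 0 < γ) (u : Fin d → ℝ) :
    γ • Lᵀ.mulVec l + γ⁻¹ • u ∈ Cgam L l γ ↔ ∀ i, 0 ≤ L.mulVec u i := by
  have h : 0 < γ⁻¹ := by positivity
  simp [Cgam, mulVec_add, mulVec_smul, ← mulVec_mulVec, h]

lemma measurable_mulVec_apply (i : Fin d) : Measurable fun x : Fin d → ℝ => L.mulVec x i := by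
  unfold mulVec dotProduct
  fun_prop

lemma measurableSet_Cgam (γ : ℝ) : MeasurableSet (Cgam L l γ) := by
  simp only [Cgam, Set.ofPred_forall]
  exact MeasurableSet.iInter fun i =>
    measurableSet_le measurable_const (measurable_mulVec_apply L i)

lemma measurableSet_cone : MeasurableSet {u : Fin d → ℝ | ∀ i, 0 ≤ L.mulVec u i} := by
  simp only [Set.ofPred_forall]
  exact MeasurableSet.iInter fun i =>
    measurableSet_le measurable_const (measurable_mulVec_apply L i)

lemma setIntegral_Cgam {γ : ℝ} (hγ : 0 < γ) (f : (Fin d → ℝ) → ℝ) :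
    ∫ x in Cgam L l γ, f x =
      γ⁻¹ ^ d * ∫ u in {u | ∀ i, 0 ≤ L.mulVec u i}, f (γ • Lᵀ.mulVec l + γ⁻¹ • u) := by
  rw [← integral_indicator (measurableSet_Cgam L l γ),
    ← integral_indicator (measurableSet_cone L),
    ← integral_add_left_eq_self _ (γ • Lᵀ.mulVec l)]
  have h := Measure.integral_comp_smul (volume : Measure (Fin d → ℝ))
    (fun x => (Cgam L l γ).indicator f (γ • Lᵀ.mulVec l + x)) γ⁻¹
  have h2 : ∀ u : Fin d → ℝ, (Cgam L l γ).indicator f (γ • Lᵀ.mulVec l + γ⁻¹ • u) =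
      {u | ∀ i, 0 ≤ L.mulVec u i}.indicator (fun u => f (γ • Lᵀ.mulVec l + γ⁻¹ • u)) u := by
    intro u
    by_cases hu : u ∈ {u : Fin d → ℝ | ∀ i, 0 ≤ L.mulVec u i}
    · rw [Set.indicator_of_mem ((mem_Cgam_iff L l hγ u).2 hu), Set.indicator_of_mem hu]
    · rw [Set.indicator_of_notMem (mt (mem_Cgam_iff L l hγ u).1 hu),
        Set.indicator_of_notMem hu]
  simp only [h2, Module.finrank_fin_fun, smul_eq_mul] at h
  rw [h, abs_of_pos (by positivity), ← mul_assoc, mul_inv_cancel₀ (by positivity), one_mul]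

lemma integrable_Cgam_comp {γ : ℝ} (hγ : 0 < γ) {f : (Fin d → ℝ) → ℝ} (hf : Integrable f) :
    Integrable fun u => f (γ • Lᵀ.mulVec l + γ⁻¹ • u) :=
  (integrable_comp_smul_iff volume (fun x => f (γ • Lᵀ.mulVec l + x))
    (inv_ne_zero hγ.ne')).2 (hf.comp_add_left _)

lemma phiD_comp {γ : ℝ} (hγ : 0 < γ) (u : Fin d → ℝ) :
    phiD (γ • Lᵀ.mulVec l + γ⁻¹ • u) =
      (√(2 * π) ^ d)⁻¹ * exp (-(γ ^ 2 * ∑ i, Lᵀ.mulVec l i ^ 2 / 2)) *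
        (exp (-(∑ i, l i * L.mulVec u i)) * exp (-(γ⁻¹ ^ 2 * ∑ i, u i ^ 2 / 2))) := by
  have h : ∑ i, l i * L.mulVec u i = ∑ i, Lᵀ.mulVec l i * u i := by
    change l ⬝ᵥ L.mulVec u = Lᵀ.mulVec l ⬝ᵥ u
    rw [dotProduct_mulVec, mulVec_transpose]
  rw [phiD, mul_assoc, ← exp_add, ← exp_add, h]
  congr 2
  simp only [Finset.mul_sum, ← Finset.sum_neg_distrib, Finset.sum_div, ← Finset.sum_add_distrib]
  refine Finset.sum_congr rfl fun i _ => ?_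
  simp only [Pi.add_apply, Pi.smul_apply, smul_eq_mul]
  field_simp
  ring

lemma det_ne_zero_of_lower (hLow : ∀ i j : Fin d, i < j → L i j = 0) (hDiag : ∀ i, 0 < L i i) :
    L.det ≠ 0 := by
  rw [Matrix.det_of_isLowerTriangular L (fun i j hij => hLow i j hij)]
  exact Finset.prod_ne_zero_iff.2 fun i _ => (hDiag i).ne'

lemma integrableOn_cone (hdet : L.det ≠ 0) (hl : ∀ i, 0 < l i) :
    IntegrableOn (fun u => exp (-(∑ i, l i * L.mulVec u i))) {u | ∀ i, 0 ≤ L.mulVec u i} := by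
  have h1 : Integrable (fun v : Fin d → ℝ =>
      ∏ i, (Set.Ici (0 : ℝ)).indicator (fun t => exp (-l i * t)) (v i)) := by
    refine Integrable.fintype_prod
      (f := fun i => (Set.Ici (0 : ℝ)).indicator (fun t => exp (-l i * t))) fun i => ?_
    rw [integrable_indicator_iff measurableSet_Ici, integrableOn_Ici_iff_integrableOn_Ioi]
    exact exp_neg_integrableOn_Ioi 0 (hl i)
  have hmap := Real.map_matrix_volume_pi_eq_smul_volume_pi hdet
  have h2 : Integrable (fun v : Fin d → ℝ =>
      ∏ i, (Set.Ici (0 : ℝ)).indicator (fun t => exp (-l i * t)) (v i))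
      (Measure.map (Matrix.toLin' L) volume) := by
    rw [hmap]
    exact h1.smul_measure ENNReal.ofReal_ne_top
  have hmeas : Measurable (Matrix.toLin' L) :=
    (LinearMap.continuous_of_finiteDimensional _).measurable
  have h3 := h2.comp_measurable hmeas
  rw [← integrable_indicator_iff (measurableSet_cone L)]
  refine h3.congr (Eventually.of_forall fun u => ?_)
  simp only [Function.comp, Matrix.toLin'_apply, Set.indicator_apply, Set.mem_ofPred_eq,
    Set.mem_Ici]
  split_ifs with h
  · simp only [h, if_true, ← exp_sum]
    simp
  · push Not at h
    obtain ⟨i, hi⟩ := h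
    exact Finset.prod_eq_zero (Finset.mem_univ i) (if_neg hi.not_ge)

lemma lTilGam_eq (hLow : ∀ i j : Fin d, i < j → L i j = 0) (hDiag : ∀ i, 0 < L i i) (γ : ℝ)
    (x : Fin d → ℝ) (k : Fin d) :
    lTilGam L l γ x k = x k - (L.mulVec x k - γ * (L * Lᵀ).mulVec l k) / L k k := by
  have h : L.mulVec x k = ∑ j ∈ Finset.Iio k, L k j * x j + L k k * x k := by
    have hs : L.mulVec x k = ∑ j ∈ Finset.Iic k, L k j * x j := by
      symm
      refine Finset.sum_subset (Finset.subset_univ _) fun j _ hj => ?_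
      rw [hLow k j (by simpa using hj), zero_mul]
    rw [hs, ← Finset.Iio_insert, Finset.sum_insert (by simp), add_comm]
  rw [lTilGam, h]
  have := (hDiag k).ne'
  field_simp
  ring

lemma exp_psiGam_zero (γ : ℝ) (x : Fin d → ℝ) :
    exp (psiGam L l γ x 0) = ∏ k, (1 - Phi (lTilGam L l γ x k)) := by
  simp only [psiGam, Pi.zero_apply, mul_zero, Finset.sum_const_zero, neg_zero, sub_zero,
    zero_pow two_ne_zero, zero_div, zero_add, exp_sum]
  exact Finset.prod_congr rfl fun k _ => exp_log (one_sub_Phi_pos _)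

lemma exp_psiGam_zero_le_one (γ : ℝ) (x : Fin d → ℝ) : exp (psiGam L l γ x 0) ≤ 1 := by
  rw [exp_psiGam_zero]
  exact Finset.prod_le_one (fun k _ => (one_sub_Phi_pos _).le)
    fun k _ => by linarith [Phi_nonneg (lTilGam L l γ x k)]

lemma integrable_exp_psiGam_zero_mul_phiD (γ : ℝ) :
    Integrable fun x => exp (psiGam L l γ x 0) * phiD x := by
  refine integrable_phiD.mono' ?_ (Eventually.of_forall fun x => ?_)
  · refine AEStronglyMeasurable.mul (Measurable.aestronglyMeasurable ?_)
      integrable_phiD.aestronglyMeasurable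
    simp only [exp_psiGam_zero]
    refine Finset.measurable_prod _ fun k _ => measurable_const.sub ?_
    refine monotone_Phi.measurable.comp ?_
    unfold lTilGam
    fun_prop
  · rw [norm_of_nonneg (mul_nonneg (exp_pos _).le (phiD_pos x).le)]
    exact mul_le_of_le_one_left (phiD_pos x).le (exp_psiGam_zero_le_one L l γ x)

lemma Mgam_zero_le_ellGam (γ : ℝ) : Mgam L l (fun _ => 0) γ ≤ ellGam L l γ :=
  setIntegral_mono (integrable_exp_psiGam_zero_mul_phiD L l γ).integrableOn
    integrable_phiD.integrableOn
    fun x => mul_le_of_le_one_left (phiD_pos x).le (exp_psiGam_zero_le_one L l γ x)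

lemma exp_psiGam_zero_lower (hLow : ∀ i j : Fin d, i < j → L i j = 0) (hDiag : ∀ i, 0 < L i i)
    {k₀ : Fin d} (hk₀ : Lᵀ.mulVec l k₀ ≤ 0) {γ : ℝ} (hγ : 1 ≤ γ) {u : Fin d → ℝ}
    (hu : ∀ i, 0 ≤ L.mulVec u i) (hu1 : ∀ i, u i ≤ 1) :
    γ * γ⁻¹ ^ d * ((∏ k, (√(2 * π))⁻¹ * exp (-(2 * |Lᵀ.mulVec l k| + 2))) *
      exp (-(γ ^ 2 * ∑ i, Lᵀ.mulVec l i ^ 2 / 2))) ≤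
    exp (psiGam L l γ (γ • Lᵀ.mulVec l + γ⁻¹ • u) 0) := by
  have hγ0 : 0 < γ := by linarith
  have hi0 : 0 < γ⁻¹ := by positivity
  have hprod : γ * γ⁻¹ ^ d * ((∏ k, (√(2 * π))⁻¹ * exp (-(2 * |Lᵀ.mulVec l k| + 2))) *
      exp (-(γ ^ 2 * ∑ i, Lᵀ.mulVec l i ^ 2 / 2))) =
      ∏ k, ((if k = k₀ then γ else 1) * γ⁻¹ * ((√(2 * π))⁻¹ *
        exp (-(2 * |Lᵀ.mulVec l k| + 2)) * exp (-(γ ^ 2 * Lᵀ.mulVec l k ^ 2 / 2)))) := by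
    have hE : exp (-(γ ^ 2 * ∑ i, Lᵀ.mulVec l i ^ 2 / 2)) =
        ∏ k, exp (-(γ ^ 2 * Lᵀ.mulVec l k ^ 2 / 2)) := by
      rw [← exp_sum, Finset.mul_sum, Finset.sum_neg_distrib]
      simp only [mul_div_assoc]
    simp only [hE, Finset.prod_mul_distrib, Finset.prod_ite_eq', Finset.mem_univ, if_true,
      Finset.prod_const, Finset.card_univ, Fintype.card_fin]
  rw [hprod, exp_psiGam_zero]
  refine Finset.prod_le_prod (fun k _ => ?_) fun k _ => one_sub_Phi_lower hγ ?_ ?_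
  · have : (0 : ℝ) < if k = k₀ then γ else 1 := by split_ifs <;> positivity
    positivity
  · rw [lTilGam_eq L l hLow hDiag]
    have h := (mem_Cgam_iff L l hγ0 u).2 hu k
    have h2 := div_nonneg (sub_nonneg.2 h) (hDiag k).le
    have h3 := mul_le_mul_of_nonneg_left (hu1 k) hi0.le
    simp only [Pi.add_apply, Pi.smul_apply, smul_eq_mul] at h2 ⊢
    linarith
  · split_ifs with h
    · exact Or.inr ⟨rfl, h ▸ hk₀⟩
    · exact Or.inl rfl

lemma volume_cone_inter_Icc_pos (hdet : L.det ≠ 0) :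
    0 < volume ({u : Fin d → ℝ | ∀ i, 0 ≤ L.mulVec u i} ∩ Set.Icc (-1) 1) := by
  have hopen : IsOpen ({u : Fin d → ℝ | ∀ i, 0 < L.mulVec u i} ∩ {u | ∀ i, |u i| < 1}) := by
    simp only [Set.ofPred_forall]
    refine IsOpen.inter (isOpen_iInter_of_finite fun i => isOpen_lt continuous_const ?_)
      (isOpen_iInter_of_finite fun i => isOpen_lt (by fun_prop) continuous_const)
    unfold mulVec dotProduct
    fun_prop
  have hne : ({u : Fin d → ℝ | ∀ i, 0 < L.mulVec u i} ∩ {u | ∀ i, |u i| < 1}).Nonempty := by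
    set v : Fin d → ℝ := L⁻¹.mulVec 1 with hv
    have hLv : L.mulVec v = 1 := by
      rw [hv, mulVec_mulVec, mul_nonsing_inv _ (isUnit_iff_ne_zero.2 hdet), one_mulVec]
    have hpos : 0 < (‖v‖ + 1)⁻¹ := by positivity
    refine ⟨(‖v‖ + 1)⁻¹ • v, fun i => ?_, fun i => ?_⟩
    · simpa [mulVec_smul, hLv] using hpos
    · rw [Pi.smul_apply, smul_eq_mul, abs_mul, abs_of_pos hpos, inv_mul_lt_iff₀ (by positivity)]
      have := norm_le_pi_norm v i
      rw [Real.norm_eq_abs] at this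
      linarith
  refine (hopen.measure_pos volume hne).trans_le (measure_mono fun u hu => ?_)
  exact ⟨fun i => (hu.1 i).le, fun i => (abs_lt.1 (hu.2 i)).1.le,
    fun i => (abs_lt.1 (hu.2 i)).2.le⟩

lemma ellGam_le (hdet : L.det ≠ 0) (hl : ∀ i, 0 < l i) {γ : ℝ} (hγ : 0 < γ) :
    ellGam L l γ ≤ γ⁻¹ ^ d * ((√(2 * π) ^ d)⁻¹ * exp (-(γ ^ 2 * ∑ i, Lᵀ.mulVec l i ^ 2 / 2)) *
      ∫ u in {u | ∀ i, 0 ≤ L.mulVec u i}, exp (-(∑ i, l i * L.mulVec u i))) := by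
  rw [ellGam, setIntegral_Cgam L l hγ]
  refine mul_le_mul_of_nonneg_left ?_ (by positivity)
  rw [← integral_const_mul]
  refine setIntegral_mono (integrable_Cgam_comp L l hγ integrable_phiD).integrableOn
    ((integrableOn_cone L l hdet hl).const_mul _) fun u => ?_
  simp only [phiD_comp L l hγ]
  gcongr
  refine mul_le_of_le_one_right (exp_pos _).le (exp_le_one_iff.2 ?_)
  have : 0 ≤ γ⁻¹ ^ 2 * ∑ i, u i ^ 2 / 2 := by positivity
  linarith

lemma exists_Mgam_zero_lower (hLow : ∀ i j : Fin d, i < j → L i j = 0)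
    (hDiag : ∀ i, 0 < L i i) {k₀ : Fin d} (hk₀ : Lᵀ.mulVec l k₀ ≤ 0) :
    ∃ m > 0, ∀ γ ≥ 1, m * γ * (γ⁻¹ ^ d * exp (-(γ ^ 2 * ∑ i, Lᵀ.mulVec l i ^ 2 / 2))) ^ 2 ≤
      Mgam L l (fun _ => 0) γ := by
  set B : Set (Fin d → ℝ) := {u | ∀ i, 0 ≤ L.mulVec u i} ∩ Set.Icc (-1) 1
  set w : (Fin d → ℝ) → ℝ := fun u =>
    exp (-(∑ i, l i * L.mulVec u i)) * exp (-(∑ i, u i ^ 2 / 2)) with hw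
  set P : ℝ := ∏ k, (√(2 * π))⁻¹ * exp (-(2 * |Lᵀ.mulVec l k| + 2))
  have hP0 : 0 < P := Finset.prod_pos fun k _ => by positivity
  have hBm : MeasurableSet B := (measurableSet_cone L).inter measurableSet_Icc
  have hwc : Continuous w := by
    rw [hw]
    unfold mulVec dotProduct
    fun_prop
  have hwi : IntegrableOn w B :=
    (hwc.continuousOn.integrableOn_compact isCompact_Icc).mono_set Set.inter_subset_right
  have hw0 : ∀ u, 0 < w u := fun u => by simp only [hw]; positivity
  have hI : 0 < ∫ u in B, w u := by
    rw [setIntegral_pos_iff_support_of_nonneg_ae (Eventually.of_forall fun u => (hw0 u).le) hwi,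
      Function.support_eq_univ fun u => (hw0 u).ne', Set.univ_inter]
    exact volume_cone_inter_Icc_pos L (det_ne_zero_of_lower L hLow hDiag)
  refine ⟨(√(2 * π) ^ d)⁻¹ * P * ∫ u in B, w u, by positivity, fun γ hγ => ?_⟩
  have hγ0 : 0 < γ := by linarith
  set E : ℝ := exp (-(γ ^ 2 * ∑ i, Lᵀ.mulVec l i ^ 2 / 2))
  have hint := integrable_Cgam_comp L l hγ0 (integrable_exp_psiGam_zero_mul_phiD L l γ)
  rw [Mgam, setIntegral_Cgam L l hγ0]
  have h1 : ∫ u in B, (γ * γ⁻¹ ^ d * (P * E)) * ((√(2 * π) ^ d)⁻¹ * E) * w u ≤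
      ∫ u in B, exp (psiGam L l γ (γ • Lᵀ.mulVec l + γ⁻¹ • u) 0) *
        phiD (γ • Lᵀ.mulVec l + γ⁻¹ • u) := by
    refine setIntegral_mono_on (hwi.const_mul _) hint.integrableOn hBm fun u hu => ?_
    rw [mul_assoc]
    refine mul_le_mul (exp_psiGam_zero_lower L l hLow hDiag hk₀ hγ hu.1 fun i => hu.2.2 i) ?_
      (mul_nonneg (by positivity) (hw0 u).le) (exp_pos _).le
    rw [phiD_comp L l hγ0]
    simp only [hw]
    gcongr
    exact mul_le_of_le_one_left (by positivity)
      (pow_le_one₀ (by positivity) (inv_le_one_of_one_le₀ hγ))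
  have h2 := h1.trans (setIntegral_mono_set hint.integrableOn
    (Eventually.of_forall fun u => mul_nonneg (exp_pos _).le (phiD_pos _).le)
    (LE.le.eventuallyLE
      (Set.inter_subset_left : B ⊆ {u | ∀ i, 0 ≤ L.mulVec u i})))
  rw [integral_const_mul] at h2
  refine le_trans (le_of_eq ?_) (mul_le_mul_of_nonneg_left h2 (by positivity))
  ring

end Cone

/-- Theorem 3, second part, divergent case: if (Lᵀl*)_k ≤ 0 for some k,
the relative error of the untilted (Genz separation-of-variables) estimator diverges:
M₀(γ)/ℓ(γ)² → ∞ as γ → ∞. -/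
theorem sov_divergent_relative_error {d : ℕ} (hd : 1 ≤ d)
    (L : Matrix (Fin d) (Fin d) ℝ)
    (hLow : ∀ i j : Fin d, i < j → L i j = 0)
    (hDiag : ∀ i, 0 < L i i)
    (lstar : Fin d → ℝ) (hlstar : ∀ k, 0 < lstar k)
    (hneg : ∃ k, Lᵀ.mulVec lstar k ≤ 0) :
    Tendsto
      (fun γ : ℝ => Mgam L lstar (fun _ => (0 : Fin d → ℝ)) γ / (ellGam L lstar γ) ^ 2)
      atTop atTop := by
  obtain ⟨k₀, hk₀⟩ := hneg
  obtain ⟨m, hm, hM⟩ := exists_Mgam_zero_lower L lstar hLow hDiag hk₀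
  set A : ℝ := (√(2 * π) ^ d)⁻¹ *
    ∫ u in {u | ∀ i, 0 ≤ L.mulVec u i}, exp (-(∑ i, lstar i * L.mulVec u i)) with hA
  have hell : ∀ γ > 0, ellGam L lstar γ ≤
      γ⁻¹ ^ d * exp (-(γ ^ 2 * ∑ i, Lᵀ.mulVec lstar i ^ 2 / 2)) * A := fun γ hγ =>
    (ellGam_le L lstar (det_ne_zero_of_lower L hLow hDiag) hlstar hγ).trans_eq (by rw [hA]; ring)
  have hpos : ∀ γ ≥ 1, 0 < ellGam L lstar γ := fun γ hγ => by
    have hγ0 : 0 < γ := by linarith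
    refine lt_of_lt_of_le ?_ ((hM γ hγ).trans (Mgam_zero_le_ellGam L lstar γ))
    positivity
  have hA0 : 0 < A :=
    pos_of_mul_pos_right ((hpos 1 le_rfl).trans_le (hell 1 one_pos)) (by positivity)
  refine tendsto_atTop_mono' atTop ?_
    (tendsto_id.const_mul_atTop (show 0 < m / A ^ 2 by positivity))
  filter_upwards [eventually_ge_atTop 1] with γ hγ
  have hγ0 : 0 < γ := by linarith
  have hl0 := hpos γ hγ
  rw [id, le_div_iff₀ (by positivity)]
  refine le_trans ?_ (hM γ hγ)
  calc m / A ^ 2 * γ * ellGam L lstar γ ^ 2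
      ≤ m / A ^ 2 * γ *
        (γ⁻¹ ^ d * exp (-(γ ^ 2 * ∑ i, Lᵀ.mulVec lstar i ^ 2 / 2)) * A) ^ 2 := by
        gcongr
        exact hell γ hγ0
    _ = _ := by
        field_simp
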